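/- Let G be a finite simple graph with T ≥ 1 triangles in which every vertex is contained in at most τ triangles, where τ ≥ 1 is a real number, let 0 < ε and let p be a real number with max(5/(ε²T)^{1/3}, (10/ε)·√(τ/T)) ≤ p ≤ 1. If each vertex of G is kept independently with probability p, T' denotes the number of triangles of G all of whose three vertices are kept, and T̂ = T'/p³, then P(|T̂ − T| ≥ ε·T) ≤ 1/20. -/

import Mathlib

open Finset

/-- Under independent Bernoulli weights, a fixed set of vertices is kept with weight `p ^ #S`. -/
lemma sum_bernoulli_weight_forall_mem {V : Type*} [Fintype V] [DecidableEq V] (p : ℝ)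
    (S : Finset V) :
    ∑ f : V → Bool, (∏ v, if f v then p else 1 - p) * (if ∀ v ∈ S, f v = true then 1 else 0)
      = p ^ #S := by
  have h (f : V → Bool) :
      (∏ v, if f v then p else 1 - p) * (if ∀ v ∈ S, f v = true then 1 else 0)
        = ∏ v, (if f v then p else 1 - p) * (if v ∈ S → f v = true then 1 else 0) := by
    rw [prod_mul_distrib, prod_ite_zero]
    simp
  have key := prod_univ_sum (fun _ : V => (univ : Finset Bool))
    (fun v b => (if b then p else 1 - p) * (if v ∈ S → b = true then (1 : ℝ) else 0))
  rw [Fintype.piFinset_univ] at key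
  rw [sum_congr rfl fun f _ => h f, ← key, ← prod_const, ← prod_subset (subset_univ S)]
  · exact prod_congr rfl fun v hv => by simp [hv]
  · intro v _ hv
    simp [hv]

lemma pow_card_union_sub_le {V : Type*} [DecidableEq V] {p : ℝ} (hp0 : 0 ≤ p) (hp1 : p ≤ 1)
    {s t : Finset V} (hs : #s = 3) (ht : #t = 3) :
    p ^ #(s ∪ t) - p ^ 6 ≤ (if s = t then p ^ 3 else 0) + ∑ v ∈ s, if v ∈ t then p ^ 4 else 0 := by
  have hnn : ∀ v ∈ s, 0 ≤ if v ∈ t then p ^ 4 else 0 := fun v _ => by positivity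
  by_cases hst : s = t
  · subst hst
    have := sum_nonneg hnn
    have : 0 ≤ p ^ 6 := by positivity
    simp only [union_self, hs, if_true]
    linarith
  by_cases hd : Disjoint s t
  · rw [card_union_of_disjoint hd, hs, ht, if_neg hst]
    simpa using sum_nonneg hnn
  · obtain ⟨v, hvs, hvt⟩ := not_disjoint_iff.mp hd
    have h1 : p ^ 4 ≤ ∑ v ∈ s, if v ∈ t then p ^ 4 else 0 := by
      simpa [hvt] using single_le_sum hnn hvs
    have h2 : 4 ≤ #(s ∪ t) := by
      by_contra! hlt
      have hsu := eq_of_subset_of_card_le (subset_union_left (s₁ := s) (s₂ := t)) (by omega)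
      have htu := eq_of_subset_of_card_le (subset_union_right (s₁ := s) (s₂ := t)) (by omega)
      exact hst (hsu.trans htu.symm)
    have h3 := pow_le_pow_of_le_one hp0 hp1 h2
    have : 0 ≤ p ^ 6 := by positivity
    rw [if_neg hst]
    linarith

/-- Variance bound for the number of kept members of a family of triples in which every point
lies in at most `τ` members. -/
lemma sum_bernoulli_weight_sq_le {V : Type*} [Fintype V] [DecidableEq V] {p τ : ℝ}
    (hp0 : 0 ≤ p) (hp1 : p ≤ 1) (A : Finset (Finset V)) (hA : ∀ t ∈ A, #t = 3)
    (hτ : ∀ v, (#{t ∈ A | v ∈ t} : ℝ) ≤ τ) :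
    ∑ f : V → Bool, (∏ v, if f v then p else 1 - p) *
        ((#{t ∈ A | ∀ v ∈ t, f v = true} : ℝ) - p ^ 3 * #A) ^ 2
      ≤ #A * p ^ 3 + 3 * #A * τ * p ^ 4 := by
  set w : (V → Bool) → ℝ := fun f => ∏ v, if f v then p else 1 - p
  set I : Finset V → (V → Bool) → ℝ := fun S f => if ∀ v ∈ S, f v = true then 1 else 0
  have hE (S : Finset V) : ∑ f, w f * I S f = p ^ #S := sum_bernoulli_weight_forall_mem p S
  have hw : ∑ f, w f = 1 := by simpa [I] using hE ∅
  have hII (s t : Finset V) (f : V → Bool) : I s f * I t f = I (s ∪ t) f := by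
    simp only [I, ← ite_and, mul_ite, mul_one, mul_zero, mem_union, or_imp, forall_and]
    simp only [and_comm]
  have hpair (s t : Finset V) (hs : #s = 3) (ht : #t = 3) :
      ∑ f, w f * ((I s f - p ^ 3) * (I t f - p ^ 3)) = p ^ #(s ∪ t) - p ^ 6 := by
    have hexp (f : V → Bool) : w f * ((I s f - p ^ 3) * (I t f - p ^ 3))
        = w f * I (s ∪ t) f - p ^ 3 * (w f * I s f) - p ^ 3 * (w f * I t f) + p ^ 6 * w f := by
      rw [← hII]
      ring
    simp only [hexp, sum_add_distrib, sum_sub_distrib, ← mul_sum, hE, hw, hs, ht]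
    ring
  have hX (f : V → Bool) : (#{t ∈ A | ∀ v ∈ t, f v = true} : ℝ) - p ^ 3 * #A
      = ∑ t ∈ A, (I t f - p ^ 3) := by
    rw [sum_sub_distrib, sum_const, nsmul_eq_mul, mul_comm (p ^ 3)]
    simp [I]
  calc ∑ f, w f * ((#{t ∈ A | ∀ v ∈ t, f v = true} : ℝ) - p ^ 3 * #A) ^ 2
      = ∑ s ∈ A, ∑ t ∈ A, ∑ f, w f * ((I s f - p ^ 3) * (I t f - p ^ 3)) := by
        simp only [hX, sq, sum_mul_sum]
        simp only [mul_sum]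
        rw [sum_comm]
        exact sum_congr rfl fun s _ => sum_comm
    _ ≤ ∑ s ∈ A, ∑ t ∈ A, ((if s = t then p ^ 3 else 0) + ∑ v ∈ s, if v ∈ t then p ^ 4 else 0) :=
        sum_le_sum fun s hs => sum_le_sum fun t ht => by
          rw [hpair s t (hA s hs) (hA t ht)]
          exact pow_card_union_sub_le hp0 hp1 (hA s hs) (hA t ht)
    _ ≤ ∑ s ∈ A, (p ^ 3 + 3 * (τ * p ^ 4)) := by
        refine sum_le_sum fun s hs => ?_
        rw [sum_add_distrib, sum_ite_eq, if_pos hs, sum_comm]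
        gcongr
        calc ∑ v ∈ s, ∑ t ∈ A, (if v ∈ t then p ^ 4 else 0) ≤ ∑ v ∈ s, τ * p ^ 4 := by
              refine sum_le_sum fun v _ => ?_
              rw [← sum_filter, sum_const, nsmul_eq_mul]
              exact mul_le_mul_of_nonneg_right (hτ v) (by positivity)
          _ = 3 * (τ * p ^ 4) := by simp [hA s hs]
    _ = #A * p ^ 3 + 3 * #A * τ * p ^ 4 := by
        rw [sum_const, nsmul_eq_mul]
        ring

/-- Chebyshev's inequality for a nonnegative weight on a finite type. -/
lemma sum_filter_mul_sq_le {ι : Type*} [Fintype ι] {w Y : ι → ℝ} (hw : ∀ i, 0 ≤ w i)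
    {c : ℝ} (hc : 0 ≤ c) (P : ι → Prop) [DecidablePred P] (hP : ∀ i, P i → c ≤ |Y i|) :
    (∑ i with P i, w i) * c ^ 2 ≤ ∑ i, w i * Y i ^ 2 := by
  rw [sum_mul]
  refine (sum_le_sum fun i hi => ?_).trans
    (sum_le_univ_sum_of_nonneg fun i => mul_nonneg (hw i) (sq_nonneg (Y i)))
  rw [← sq_abs (Y i)]
  exact mul_le_mul_of_nonneg_left
    (pow_le_pow_left₀ hc (hP i (mem_filter.mp hi).2) 2) (hw i)

open scoped Classical in
/-- Let `G` be a finite simple graph with `T ≥ 1` triangles in which every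
vertex lies in at most `τ` triangles (`τ ≥ 1`), let `ε > 0` and let
`max(5/(ε²T)^{1/3}, (10/ε)·√(τ/T)) ≤ p ≤ 1`. Keep each vertex independently with
probability `p`; if `T'` counts the fully-kept triangles and `T̂ = T'/p³`, then
`P(|T̂ − T| ≥ ε·T) ≤ 1/20`. -/
theorem sampled_triangle_estimate_concentration
    {V : Type*} [Fintype V] [DecidableEq V]
    (G : SimpleGraph V) [DecidableRel G.Adj] (τ ε p : ℝ) (hτ : 1 ≤ τ) (hε : 0 < ε)
    (hT1 : 1 ≤ (G.cliqueFinset 3).card)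
    (hlight : ∀ v : V, (((G.cliqueFinset 3).filter (fun t => v ∈ t)).card : ℝ) ≤ τ)
    (hpl : max (5 / (ε ^ 2 * ((G.cliqueFinset 3).card : ℝ)) ^ ((1 : ℝ) / 3))
        ((10 / ε) * Real.sqrt (τ / ((G.cliqueFinset 3).card : ℝ))) ≤ p)
    (hp1 : p ≤ 1) :
    (∑ f ∈ (Finset.univ : Finset (V → Bool)).filter (fun f =>
        ε * ((G.cliqueFinset 3).card : ℝ) ≤
          |(((G.cliqueFinset 3).filter (fun Δ => ∀ v ∈ Δ, f v = true)).card : ℝ) / p ^ 3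
            - ((G.cliqueFinset 3).card : ℝ)|),
      (∏ v : V, if f v then p else 1 - p))
    ≤ 1 / 20 := by
  set T : ℝ := ((G.cliqueFinset 3).card : ℝ)
  have hT : 0 < T := by
    have : (1 : ℝ) ≤ T := Nat.one_le_cast.mpr hT1
    linarith
  obtain ⟨hpc, hps⟩ := max_le_iff.mp hpl
  have hp0 : 0 < p := lt_of_lt_of_le (by positivity) hpc
  have hcube : 125 ≤ p ^ 3 * (ε ^ 2 * T) := by
    have h0 : 0 < (ε ^ 2 * T) ^ ((1 : ℝ) / 3) := by positivity
    have h1 := pow_le_pow_left₀ (by norm_num) ((div_le_iff₀ h0).mp hpc) 3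
    rw [mul_pow, ← Real.rpow_natCast (_ ^ ((1 : ℝ) / 3)), ← Real.rpow_mul (by positivity)] at h1
    norm_num at h1
    exact h1
  have hsq : 100 * τ ≤ p ^ 2 * (ε ^ 2 * T) := by
    have h1 := pow_le_pow_left₀ (by positivity) hps 2
    rw [mul_pow, Real.sq_sqrt (by positivity), div_pow, div_mul_div_comm,
      div_le_iff₀ (by positivity)] at h1
    linarith
  have hvar := sum_bernoulli_weight_sq_le hp0.le hp1 (G.cliqueFinset 3)
    (fun t ht => (SimpleGraph.mem_cliqueFinset_iff.mp ht).card_eq)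
    (fun v => by convert hlight v)
  have hcheb := sum_filter_mul_sq_le
    (w := fun f : V → Bool => ∏ v : V, if f v then p else 1 - p)
    (Y := fun f => (#{t ∈ G.cliqueFinset 3 | ∀ v ∈ t, f v = true} : ℝ) - p ^ 3 * T)
    (fun f => prod_nonneg fun v _ => by split_ifs <;> linarith)
    (c := ε * T * p ^ 3) (by positivity)
    (fun f => ε * T ≤ |(#{t ∈ G.cliqueFinset 3 | ∀ v ∈ t, f v = true} : ℝ) / p ^ 3 - T|)
    (fun f hf => by
      have h3 : 0 < p ^ 3 := by positivity
      have := mul_le_mul_of_nonneg_right hf h3.le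
      rwa [← abs_of_pos h3, ← abs_mul, abs_of_pos h3, sub_mul, div_mul_cancel₀ _ h3.ne',
        mul_comm T] at this)
  have hbound : T * p ^ 3 + 3 * T * τ * p ^ 4 ≤ 1 / 20 * (ε * T * p ^ 3) ^ 2 := by
    have h1 := mul_le_mul_of_nonneg_left hcube (by positivity : 0 ≤ T * p ^ 3)
    have h2 := mul_le_mul_of_nonneg_left hsq (by positivity : 0 ≤ T * p ^ 4)
    have h3 : 0 ≤ T ^ 2 * ε ^ 2 * p ^ 6 := by positivity
    linarith
  have hfin := le_of_mul_le_mul_right (hcheb.trans (hvar.trans hbound))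
    (by positivity : 0 < (ε * T * p ^ 3) ^ 2)
  convert hfin
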